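/- arXiv:2310.10256 — 4 statements merged into one kernel-verified Lean document; each statement's English description precedes it below -/
import Mathlib

section
/- Let G be a group, let X be a subset of G and let Y₁, …, Yₙ be subsets of G. Assume that there exist finite subsets F₁, …, Fₙ of G such that X ⊆ Fᵢ·Yᵢ for all i ∈ {1,…,n}. Then there exists a finite subset F' of X with |F'| ≤ |F₁|·…·|Fₙ| such that X ⊆ F'·(Y₁⁻¹·Y₁ ∩ … ∩ Yₙ⁻¹·Yₙ). -/
open Pointwise

theorem intersection_of_commensurable_sets {G : Type*} [Group G] (n : ℕ)
    (X : Set G) (Y : Fin n → Set G) (F : Fin n → Finset G)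
    (hXF : ∀ i, X ⊆ (F i : Set G) * Y i) :
    ∃ F' : Finset G, (F' : Set G) ⊆ X ∧ F'.card ≤ ∏ i, (F i).card ∧
      X ⊆ (F' : Set G) * ⋂ i, (Y i)⁻¹ * Y i := by
  classical
  let Q : (Fin n → G) → Prop := fun p ↦ ∃ x ∈ X, ∀ i, (p i)⁻¹ * x ∈ Y i
  have hQ : ∀ p, Q p → ∃ x, x ∈ X ∧ ∀ i, (p i)⁻¹ * x ∈ Y i := fun _ h ↦ h
  choose! r hrX hrY using hQ
  refine ⟨((Fintype.piFinset F).filter Q).image r, ?_, ?_, ?_⟩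
  · intro x hx
    obtain ⟨p, hp, rfl⟩ := Finset.mem_image.1 (Finset.mem_coe.1 hx)
    exact hrX p (Finset.mem_filter.1 hp).2
  · calc
      _ ≤ ((Fintype.piFinset F).filter Q).card := Finset.card_image_le
      _ ≤ (Fintype.piFinset F).card := Finset.card_filter_le _ _
      _ = ∏ i, (F i).card := Fintype.card_piFinset F
  · intro x hx
    have hp : ∀ i, ∃ a ∈ F i, a⁻¹ * x ∈ Y i := fun i ↦ by
      obtain ⟨a, ha, y, hy, rfl⟩ := Set.mem_mul.1 (hXF i hx)
      exact ⟨a, ha, by simpa using hy⟩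
    choose p hpF hpY using hp
    have hQp : Q p := ⟨x, hx, hpY⟩
    refine Set.mem_mul.2 ⟨r p, Finset.mem_coe.2 (Finset.mem_image_of_mem r
      (Finset.mem_filter.2 ⟨Fintype.mem_piFinset.2 hpF, hQp⟩)), (r p)⁻¹ * x, ?_, by group⟩
    refine Set.mem_iInter.2 fun i ↦ Set.mem_mul.2
      ⟨((p i)⁻¹ * r p)⁻¹, Set.inv_mem_inv.2 (hrY p hQp i), (p i)⁻¹ * x, hpY i, by group⟩
end

section
/- Let Λ₁, …, Λₙ be K₁-, …, Kₙ-approximate subgroups of a group G and let k₁, …, kₙ ≥ 2 be integers. Then there exists a finite subset F of G with |F| ≤ K₁^{k₁−1}·…·Kₙ^{kₙ−1} such that Λ₁^{k₁} ∩ … ∩ Λₙ^{kₙ} ⊆ F·(Λ₁² ∩ … ∩ Λₙ²). -/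
open Pointwise

/-- `Λ` is a `K`-approximate subgroup of `G`: it is symmetric, contains the identity,
and `Λ · Λ` is covered by at most `K` left-translates of `Λ`. -/
def IsApproxSubgroup {G : Type*} [Group G] (K : ℕ) (Λ : Set G) : Prop :=
  Λ⁻¹ = Λ ∧ (1 : G) ∈ Λ ∧ ∃ F : Finset G, F.card ≤ K ∧ Λ * Λ ⊆ (F : Set G) * Λ

/-- The powers of an approximate subgroup are covered by few left-translates of it. -/
theorem IsApproxSubgroup.exists_pow_succ_subset {G : Type*} [Group G] {K : ℕ} {Λ : Set G}
    (h : IsApproxSubgroup K Λ) (m : ℕ) :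
    ∃ F : Finset G, F.card ≤ K ^ m ∧ Λ ^ (m + 1) ⊆ (F : Set G) * Λ := by
  classical
  obtain ⟨-, -, F, hF, hΛ⟩ := h
  refine ⟨F ^ m, Finset.card_pow_le.trans (Nat.pow_le_pow_left hF m), ?_⟩
  induction m with
  | zero => simp
  | succ m ih =>
    calc Λ ^ (m + 1 + 1) = Λ ^ (m + 1) * Λ := pow_succ _ _
      _ ⊆ (↑(F ^ m) * Λ) * Λ := Set.mul_subset_mul_right ih
      _ = ↑(F ^ m) * (Λ * Λ) := mul_assoc _ _ _
      _ ⊆ ↑(F ^ m) * (↑F * Λ) := Set.mul_subset_mul_left hΛ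
      _ = ↑(F ^ (m + 1)) * Λ := by rw [← mul_assoc, pow_succ, Finset.coe_mul]

/-- If `x` and `y` lie in the same left-translate of a symmetric set `Λ`, then
`x⁻¹ * y ∈ Λ ^ 2`. -/
theorem inv_mul_mem_sq_of_inv_mul_mem {G : Type*} [Group G] {Λ : Set G} (hΛ : Λ⁻¹ = Λ)
    {a x y : G} (hx : a⁻¹ * x ∈ Λ) (hy : a⁻¹ * y ∈ Λ) : x⁻¹ * y ∈ Λ ^ 2 := by
  have hx' : (a⁻¹ * x)⁻¹ ∈ Λ := by rw [← hΛ]; exact Set.inv_mem_inv.2 hx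
  rw [sq]
  exact ⟨_, hx', _, hy, by group⟩

theorem intersection_of_powers_covered {G : Type*} [Group G] (n : ℕ)
    (Λ : Fin n → Set G) (K k : Fin n → ℕ)
    (hK : ∀ i, IsApproxSubgroup (K i) (Λ i)) (hk : ∀ i, 2 ≤ k i) :
    ∃ F : Finset G, F.card ≤ ∏ i, (K i) ^ (k i - 1) ∧
      (⋂ i, Λ i ^ (k i)) ⊆ (F : Set G) * ⋂ i, (Λ i) ^ 2 := by
  classical
  choose F hFcard hF using fun i => (hK i).exists_pow_succ_subset (k i - 1)
  have hrep : ∀ f : Fin n → G, ∃ x : G,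
      (∃ y, ∀ i, (f i)⁻¹ * y ∈ Λ i) → ∀ i, (f i)⁻¹ * x ∈ Λ i := fun f => by
    by_cases h : ∃ y, ∀ i, (f i)⁻¹ * y ∈ Λ i
    · exact h.imp fun _ hy _ => hy
    · exact ⟨1, fun h' => absurd h' h⟩
  choose r hr using hrep
  refine ⟨(Fintype.piFinset F).image r, ?_, fun y hy => ?_⟩
  · refine Finset.card_image_le.trans ?_
    rw [Fintype.card_piFinset]
    exact Finset.prod_le_prod' fun i _ => hFcard i
  · have hcover : ∀ i, ∃ a ∈ F i, a⁻¹ * y ∈ Λ i := fun i => by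
      have hyi := Set.mem_iInter.1 hy i
      rw [← Nat.sub_add_cancel (one_le_two.trans (hk i))] at hyi
      obtain ⟨a, ha, b, hb, rfl⟩ := hF i hyi
      exact ⟨a, ha, by simpa using hb⟩
    choose f hfF hf using hcover
    refine ⟨r f, ?_, (r f)⁻¹ * y, Set.mem_iInter.2 fun i => ?_, mul_inv_cancel_left _ _⟩
    · exact Finset.mem_coe.2 (Finset.mem_image_of_mem r (Fintype.mem_piFinset.2 hfF))
    · exact inv_mul_mem_sq_of_inv_mul_mem (hK i).1 (hr f ⟨y, hf⟩ i) (hf i)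
end

section
/- Let Λ₁, …, Λₙ be K₁-, …, Kₙ-approximate subgroups of a group G and let k₁, …, kₙ ≥ 2 be integers. Then Λ₁^{k₁} ∩ … ∩ Λₙ^{kₙ} is a (K₁^{2k₁−1}·…·Kₙ^{2kₙ−1})-approximate subgroup of G. -/
open Pointwise

/-- If `A * A` is covered by the translates of `A` by `F`, then `A ^ (m + 1)` is covered by
the translates of `A` by `F ^ m`. -/
theorem Set.pow_succ_subset_pow_mul {M : Type*} [Monoid M] {A F : Set M}
    (h : A * A ⊆ F * A) (m : ℕ) : A ^ (m + 1) ⊆ F ^ m * A := by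
  induction m with
  | zero => simp
  | succ m ih =>
    calc A ^ (m + 1 + 1) = A ^ (m + 1) * A := pow_succ _ _
      _ ⊆ F ^ m * A * A := Set.mul_subset_mul_right ih
      _ = F ^ m * (A * A) := mul_assoc _ _ _
      _ ⊆ F ^ m * (F * A) := Set.mul_subset_mul_left h
      _ = F ^ (m + 1) * A := by rw [← mul_assoc, pow_succ]

theorem intersection_of_powers_isApproxSubgroup {G : Type*} [Group G] (n : ℕ)
    (Λ : Fin n → Set G) (K k : Fin n → ℕ)
    (hK : ∀ i, IsApproxSubgroup (K i) (Λ i)) (hk : ∀ i, 2 ≤ k i) :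
    IsApproxSubgroup (∏ i, (K i) ^ (2 * k i - 1)) (⋂ i, Λ i ^ (k i)) := by
  classical
  choose hinv hone F hF hmul using hK
  refine ⟨?_, ?_, ?_⟩
  · simp only [Set.iInter_inv, ← inv_pow, hinv]
  · exact Set.mem_iInter.2 fun i => Set.one_mem_pow (hone i)
  set X : Set G := ⋂ i, Λ i ^ k i with hX
  let T : Finset (Fin n → G) := Fintype.piFinset fun i => F i ^ (2 * k i - 1)
  let P : (Fin n → G) → G → Prop := fun f x => x ∈ X * X ∧ ∀ i, (f i)⁻¹ * x ∈ Λ i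
  let g : (Fin n → G) → G := fun f => Classical.epsilon (P f)
  refine ⟨T.image g, ?_, ?_⟩
  · calc (T.image g).card ≤ T.card := Finset.card_image_le
      _ = ∏ i, (F i ^ (2 * k i - 1)).card := Fintype.card_piFinset _
      _ ≤ ∏ i, K i ^ (2 * k i - 1) := Finset.prod_le_prod' fun i _ =>
          Finset.card_pow_le.trans (Nat.pow_le_pow_left (hF i) _)
  · intro x hx
    have hcover : ∀ i, ∃ a ∈ F i ^ (2 * k i - 1), a⁻¹ * x ∈ Λ i := by
      intro i
      have hsub : X ⊆ Λ i ^ k i := Set.iInter_subset _ i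
      have hxi : x ∈ Λ i ^ (2 * k i - 1 + 1) := by
        have h := Set.mul_subset_mul hsub hsub hx
        rwa [← pow_add, show k i + k i = 2 * k i - 1 + 1 by have := hk i; omega] at h
      obtain ⟨a, ha, b, hb, rfl⟩ := Set.pow_succ_subset_pow_mul (hmul i) _ hxi
      exact ⟨a, by exact_mod_cast ha, by simpa using hb⟩
    choose f hfF hfx using hcover
    have hg : P f (g f) := Classical.epsilon_spec (p := P f) ⟨x, hx, hfx⟩
    refine ⟨g f, Finset.mem_coe.2 (Finset.mem_image_of_mem g (Fintype.mem_piFinset.2 hfF)),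
      (g f)⁻¹ * x, Set.mem_iInter.2 fun i => ?_, mul_inv_cancel_left _ _⟩
    have hgi : ((f i)⁻¹ * g f)⁻¹ ∈ Λ i := by
      rw [← Set.mem_inv, hinv i]
      exact hg.2 i
    refine Set.pow_subset_pow_right (hone i) (hk i) ?_
    rw [sq]
    exact ⟨_, hgi, _, hfx i, by simp [mul_assoc]⟩
end

section
/- Let Λ₁, …, Λₙ and Λ₁', …, Λₙ' be approximate subgroups of a group G such that Λᵢ' is commensurable with Λᵢ for all 1 ≤ i ≤ n. Then Λ₁'² ∩ … ∩ Λₙ'² is commensurable with Λ₁² ∩ … ∩ Λₙ². -/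
open Pointwise

/-- Two subsets `X`, `Y` of a group are commensurable if there is a finite set `F`
with `X ⊆ F·Y ∩ Y·F` and `Y ⊆ F·X ∩ X·F`. -/
def SetCommensurable {G : Type*} [Group G] (X Y : Set G) : Prop :=
  ∃ F : Finset G, X ⊆ (F : Set G) * Y ∩ Y * (F : Set G) ∧
    Y ⊆ (F : Set G) * X ∩ X * (F : Set G)

/-- If each `A i` is covered by finitely many left-translates of `B i`, then `⋂ i, A i` is covered
by finitely many left-translates of `⋂ i, (B i)⁻¹ * B i`. -/
theorem exists_finset_iInter_subset_mul {G ι : Type*} [Group G] [Finite ι] {A B : ι → Set G}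
    (h : ∀ i, ∃ F : Finset G, A i ⊆ (F : Set G) * B i) :
    ∃ T : Finset G, ⋂ i, A i ⊆ (T : Set G) * ⋂ i, (B i)⁻¹ * B i := by
  choose F hF using h
  have hc : ∀ x : G, ∃ f : ι → G, x ∈ ⋂ i, A i → ∀ i, f i ∈ F i ∧ (f i)⁻¹ * x ∈ B i := by
    intro x
    by_cases hx : x ∈ ⋂ i, A i
    · have hxi : ∀ i, ∃ g, g ∈ F i ∧ g⁻¹ * x ∈ B i := by
        intro i
        obtain ⟨g, hg, b, hb, rfl⟩ := hF i (Set.mem_iInter.1 hx i)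
        exact ⟨g, hg, by simpa using hb⟩
      choose f hf using hxi
      exact ⟨f, fun _ => hf⟩
    · exact ⟨1, fun h => absurd h hx⟩
  choose c hc using hc
  have hfin : (Set.pi Set.univ fun i => (F i : Set G)).Finite :=
    Set.Finite.pi' (fun i => (F i).finite_toSet) |>.subset fun f hf i => hf i trivial
  refine ⟨(hfin.image (Function.invFunOn c (⋂ i, A i))).toFinset, fun x hx => ?_⟩
  have hex : ∃ y ∈ ⋂ i, A i, c y = c x := ⟨x, hx, rfl⟩
  set y := Function.invFunOn c (⋂ i, A i) (c x) with hy
  have hyA : y ∈ ⋂ i, A i := Function.invFunOn_mem hex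
  have hcy : c y = c x := Function.invFunOn_eq hex
  refine ⟨y, ?_, y⁻¹ * x, Set.mem_iInter.2 fun i => ?_, by simp⟩
  · rw [Set.Finite.coe_toFinset]
    exact ⟨c x, fun i _ => (hc x hx i).1, rfl⟩
  · refine ⟨((c x i)⁻¹ * y)⁻¹, Set.inv_mem_inv.2 ?_, _, (hc x hx i).2, by simp [mul_assoc]⟩
    rw [← hcy]
    exact (hc y hyA i).2

theorem IsApproxSubgroup.exists_finset_sq_subset {G : Type*} [Group G] {K : ℕ} {X Y : Set G}
    (hX : IsApproxSubgroup K X) (h : ∃ F : Finset G, X ⊆ (F : Set G) * Y) :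
    ∃ F : Finset G, X ^ 2 ⊆ (F : Set G) * Y := by
  classical
  obtain ⟨-, -, E, -, hE⟩ := hX
  obtain ⟨F, hF⟩ := h
  refine ⟨E * F, ?_⟩
  rw [sq, Finset.coe_mul, mul_assoc]
  exact hE.trans (Set.mul_subset_mul_left hF)

theorem IsApproxSubgroup.exists_finset_iInter_sq_subset {G ι : Type*} [Group G] [Finite ι]
    {X Y : ι → Set G} (hX : ∀ i, ∃ K, IsApproxSubgroup K (X i))
    (hY : ∀ i, ∃ K, IsApproxSubgroup K (Y i))
    (h : ∀ i, ∃ F : Finset G, X i ⊆ (F : Set G) * Y i) :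
    ∃ T : Finset G, ⋂ i, X i ^ 2 ⊆ (T : Set G) * ⋂ i, Y i ^ 2 := by
  have hsq : ∀ i, (Y i)⁻¹ * Y i = Y i ^ 2 := fun i => by
    obtain ⟨K, hK⟩ := hY i
    rw [hK.1, sq]
  simpa only [hsq] using exists_finset_iInter_subset_mul (A := fun i => X i ^ 2) (B := Y)
    fun i => (hX i).choose_spec.exists_finset_sq_subset (h i)

theorem IsApproxSubgroup.inv_iInter_sq {G ι : Type*} [Group G] {X : ι → Set G}
    (hX : ∀ i, ∃ K, IsApproxSubgroup K (X i)) : (⋂ i, X i ^ 2)⁻¹ = ⋂ i, X i ^ 2 := by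
  rw [Set.iInter_inv]
  refine Set.iInter_congr fun i => ?_
  obtain ⟨K, hK⟩ := hX i
  rw [← inv_pow, hK.1]

theorem subset_mul_inv_of_subset_mul {G : Type*} [Group G] {X Y S : Set G} (hX : X⁻¹ = X)
    (hY : Y⁻¹ = Y) (h : X ⊆ S * Y) : X ⊆ Y * S⁻¹ := by
  simpa only [mul_inv_rev, hX, hY] using Set.inv_subset_inv.2 h

theorem subset_inv_mul_of_subset_mul {G : Type*} [Group G] {X Y S : Set G} (hX : X⁻¹ = X)
    (hY : Y⁻¹ = Y) (h : X ⊆ Y * S) : X ⊆ S⁻¹ * Y := by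
  simpa only [mul_inv_rev, hX, hY] using Set.inv_subset_inv.2 h

/-- For symmetric sets, commensurability is the same as each set being covered by finitely many
left-translates of the other. In `SetCommensurable`, `F * Y ∩ Y * F` parses as `(F * Y ∩ Y) * F`,
because `*` and `∩` have the same precedence; this lemma shows that for symmetric sets the
resulting notion agrees with the one for `(F * Y) ∩ (Y * F)`. -/
theorem setCommensurable_iff_of_inv_eq {G : Type*} [Group G] {X Y : Set G} (hX : X⁻¹ = X)
    (hY : Y⁻¹ = Y) : SetCommensurable X Y ↔
      (∃ S : Finset G, X ⊆ (S : Set G) * Y) ∧ ∃ T : Finset G, Y ⊆ (T : Set G) * X := by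
  classical
  constructor
  · rintro ⟨F, hXY, hYX⟩
    have hXY' := hXY.trans (Set.mul_subset_mul_right Set.inter_subset_right)
    have hYX' := hYX.trans (Set.mul_subset_mul_right Set.inter_subset_right)
    refine ⟨⟨F⁻¹, ?_⟩, ⟨F⁻¹, ?_⟩⟩ <;> rw [Finset.coe_inv]
    · exact subset_inv_mul_of_subset_mul hX hY hXY'
    · exact subset_inv_mul_of_subset_mul hY hX hYX'
  · rintro ⟨⟨S, hS⟩, T, hT⟩
    set F : Finset G := insert 1 (S⁻¹ ∪ T⁻¹) with hF
    have one_mem : (1 : G) ∈ (F : Set G) := by simp [hF]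
    have hSF : (S : Set G)⁻¹ ⊆ F := by
      rw [← Finset.coe_inv, Finset.coe_subset]
      exact Finset.subset_union_left.trans (Finset.subset_insert _ _)
    have hTF : (T : Set G)⁻¹ ⊆ F := by
      rw [← Finset.coe_inv, Finset.coe_subset]
      exact Finset.subset_union_right.trans (Finset.subset_insert _ _)
    refine ⟨F, ?_, ?_⟩
    · rw [Set.inter_eq_right.2 (Set.subset_mul_right Y one_mem)]
      exact (subset_mul_inv_of_subset_mul hX hY hS).trans (Set.mul_subset_mul_left hSF)
    · rw [Set.inter_eq_right.2 (Set.subset_mul_right X one_mem)]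
      exact (subset_mul_inv_of_subset_mul hY hX hT).trans (Set.mul_subset_mul_left hTF)

theorem intersection_of_squares_commensurable {G : Type*} [Group G] (n : ℕ)
    (Λ Λ' : Fin n → Set G)
    (hΛ : ∀ i, ∃ K, IsApproxSubgroup K (Λ i))
    (hΛ' : ∀ i, ∃ K, IsApproxSubgroup K (Λ' i))
    (hcomm : ∀ i, SetCommensurable (Λ' i) (Λ i)) :
    SetCommensurable (⋂ i, (Λ' i) ^ 2) (⋂ i, (Λ i) ^ 2) := by
  have hcover := fun i => (setCommensurable_iff_of_inv_eq (hΛ' i).choose_spec.1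
    (hΛ i).choose_spec.1).1 (hcomm i)
  exact (setCommensurable_iff_of_inv_eq (IsApproxSubgroup.inv_iInter_sq hΛ')
    (IsApproxSubgroup.inv_iInter_sq hΛ)).2
      ⟨IsApproxSubgroup.exists_finset_iInter_sq_subset hΛ' hΛ fun i => (hcover i).1,
        IsApproxSubgroup.exists_finset_iInter_sq_subset hΛ hΛ' fun i => (hcover i).2⟩
end
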